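/- Let K be a compact subset of the unit circle of arclength measure 0 and L a compact subset of the open unit disc. Let φ : K → ℂ be continuous with |φ| ≡ 1 on K, and let f be holomorphic on the open unit disc with |f| ≤ 1. Then for every ε > 0 there exists a finite Blaschke product B such that sup_{z∈K} |B(z) − φ(z)| < ε and sup_{z∈L} |B(z) − f(z)| < ε. -/

import Mathlib

open Complex Metric MeasureTheory Filter Set

noncomputable section

/-- A finite Blaschke product: a unimodular constant times a finite product of
disc automorphisms `z ↦ (z - wₖ)/(1 - conj wₖ · z)` with `wₖ` in the open unit disc. -/
def IsFiniteBlaschke (B : ℂ → ℂ) : Prop :=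
  ∃ (n : ℕ) (ζ : ℂ) (w : Fin (n + 1) → ℂ),
    ‖ζ‖ = 1 ∧ (∀ k, ‖w k‖ < 1) ∧
    ∀ z : ℂ, B z = ζ * ∏ k, (z - w k) / (1 - (starRingEnd ℂ) (w k) * z)

/-- Arclength measure on the unit circle, viewed as a measure on `ℂ`. -/
def arclength : Measure ℂ :=
  Measure.map (circleMap 0 1) (volume.restrict (Set.Ioc 0 (2 * Real.pi)))


open Polynomial ComplexConjugate

/-- The Blaschke product with zeros `s` and no unimodular factor. -/
def blaschkeProd (s : Multiset ℂ) (z : ℂ) : ℂ :=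
  (s.map fun w => (z - w) / (1 - conj w * z)).prod

lemma blaschkeProd_add (s t : Multiset ℂ) (z : ℂ) :
    blaschkeProd (s + t) z = blaschkeProd s z * blaschkeProd t z := by
  simp [blaschkeProd]

lemma one_sub_conj_mul_ne_zero {w z : ℂ} (hw : ‖w‖ < 1) (hz : ‖z‖ ≤ 1) :
    1 - conj w * z ≠ 0 := by
  intro h
  have h1 : ‖conj w * z‖ = 1 := by rw [← sub_eq_zero.mp h, norm_one]
  rw [norm_mul, RCLike.norm_conj] at h1
  nlinarith [norm_nonneg w, norm_nonneg z]

lemma normSq_one_sub_conj_mul_sub (w z : ℂ) :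
    normSq (1 - conj w * z) - normSq (z - w) = (1 - normSq z) * (1 - normSq w) := by
  simp only [normSq_apply, sub_re, sub_im, mul_re, mul_im, conj_re, conj_im, one_re, one_im]
  ring

lemma norm_blaschkeProd_le_one {s : Multiset ℂ} (hs : ∀ w ∈ s, ‖w‖ < 1) {z : ℂ}
    (hz : ‖z‖ ≤ 1) : ‖blaschkeProd s z‖ ≤ 1 := by
  induction s using Multiset.induction_on with
  | empty => simp [blaschkeProd]
  | cons w s ih =>
    have hw := hs w (Multiset.mem_cons_self w s)
    rw [blaschkeProd, Multiset.map_cons, Multiset.prod_cons, norm_mul]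
    refine mul_le_one₀ ?_ (norm_nonneg _) (ih fun v hv => hs v (Multiset.mem_cons_of_mem hv))
    rw [norm_div, div_le_one (norm_pos_iff.mpr (one_sub_conj_mul_ne_zero hw hz))]
    apply le_of_sq_le_sq _ (norm_nonneg _)
    have h := normSq_one_sub_conj_mul_sub w z
    simp only [normSq_eq_norm_sq] at h
    nlinarith [mul_nonneg (by nlinarith [norm_nonneg z] : 0 ≤ 1 - ‖z‖ ^ 2)
      (by nlinarith [norm_nonneg w] : 0 ≤ 1 - ‖w‖ ^ 2)]

lemma norm_blaschkeProd_eq_one {s : Multiset ℂ} (hs : ∀ w ∈ s, ‖w‖ < 1) {z : ℂ}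
    (hz : ‖z‖ = 1) : ‖blaschkeProd s z‖ = 1 := by
  induction s using Multiset.induction_on with
  | empty => simp [blaschkeProd]
  | cons w s ih =>
    have hw := hs w (Multiset.mem_cons_self w s)
    rw [blaschkeProd, Multiset.map_cons, Multiset.prod_cons, norm_mul]
    have h1 : ‖(s.map fun w => (z - w) / (1 - conj w * z)).prod‖ = 1 :=
      ih fun v hv => hs v (Multiset.mem_cons_of_mem hv)
    rw [h1, mul_one, norm_div,
      div_eq_one_iff_eq (norm_pos_iff.mpr (one_sub_conj_mul_ne_zero hw hz.le)).ne']
    have h := normSq_one_sub_conj_mul_sub w z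
    simp only [normSq_eq_norm_sq, hz] at h
    exact (sq_eq_sq₀ (norm_nonneg _) (norm_nonneg _)).mp (by linarith)

lemma continuousOn_blaschkeProd {s : Multiset ℂ} (hs : ∀ w ∈ s, ‖w‖ < 1) :
    ContinuousOn (blaschkeProd s) (closedBall 0 1) := by
  induction s using Multiset.induction_on with
  | empty => exact (continuousOn_const (c := (1 : ℂ))).congr fun z _ => by simp [blaschkeProd]
  | cons w s ih =>
    have hw := hs w (Multiset.mem_cons_self w s)
    have h1 := ih fun v hv => hs v (Multiset.mem_cons_of_mem hv)
    have h2 : ContinuousOn (fun z : ℂ => (z - w) / (1 - conj w * z)) (closedBall 0 1) := by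
      refine ContinuousOn.div (by fun_prop) (by fun_prop) fun z hz => ?_
      exact one_sub_conj_mul_ne_zero hw (mem_closedBall_zero_iff.mp hz)
    refine (h2.mul h1).congr fun z _ => ?_
    simp [blaschkeProd]

lemma isFiniteBlaschke_const_mul_blaschkeProd {ζ : ℂ} (hζ : ‖ζ‖ = 1) {s : Multiset ℂ}
    (hs : ∀ w ∈ s, ‖w‖ < 1) (hs0 : s ≠ 0) :
    IsFiniteBlaschke fun z => ζ * blaschkeProd s z := by
  obtain ⟨l, rfl⟩ : ∃ l : List ℂ, (l : Multiset ℂ) = s := ⟨s.toList, s.coe_toList⟩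
  obtain ⟨n, hn⟩ : ∃ n, l.length = n + 1 :=
    Nat.exists_eq_succ_of_ne_zero fun h => hs0 (by simp [List.length_eq_zero_iff.mp h])
  refine ⟨n, ζ, fun k => l.get (k.cast hn.symm), hζ, fun k => hs _ (by simp), fun z => ?_⟩
  have h := Fin.prod_univ_fun_getElem l (fun w => (z - w) / (1 - conj w * z))
  simp only [blaschkeProd, Multiset.map_coe, Multiset.prod_coe]
  rw [← h]
  exact congrArg (ζ * ·) (Equiv.prod_comp (finCongr hn.symm)
    fun i : Fin l.length => (z - l[i.1]) / (1 - conj l[i.1] * z)).symm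

lemma exists_polynomial_approx {L : Set ℂ} (hLc : IsCompact L) (hLD : L ⊆ ball (0:ℂ) 1)
    {f : ℂ → ℂ} (hf : DifferentiableOn ℂ f (ball (0:ℂ) 1))
    (hfb : ∀ z ∈ ball (0:ℂ) 1, ‖f z‖ ≤ 1) {ε : ℝ} (hε : 0 < ε) :
    ∃ G : ℂ[X], (∃ s < 1, ∀ z : ℂ, ‖z‖ ≤ 1 → ‖G.eval z‖ ≤ s) ∧
      ∀ z ∈ L, ‖G.eval z - f z‖ < ε := by
  obtain ⟨ρ, hρ0, hρ1, hLρ⟩ : ∃ ρ : ℝ, 0 < ρ ∧ ρ < 1 ∧ ∀ z ∈ L, ‖z‖ ≤ ρ := by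
    obtain ⟨ρ, hρ, h⟩ := exists_pos_lt_subset_ball one_pos hLc.isClosed hLD
    exact ⟨ρ, hρ.1, hρ.2, fun z hz => (mem_ball_zero_iff.mp (h hz)).le⟩
  set η : ℝ := min (ε / 8) (1 / 4) with hη_def
  have hη : 0 < η := by positivity
  have hη4 : η ≤ 1 / 4 := min_le_right _ _
  have hηε : 8 * η ≤ ε := by linarith [min_le_left (ε / 8) (1 / 4 : ℝ)]
  have huc : UniformContinuousOn f (closedBall 0 ρ) :=
    (isCompact_closedBall 0 ρ).uniformContinuousOn_of_continuous
      (hf.continuousOn.mono (closedBall_subset_ball hρ1))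
  obtain ⟨d, hd, huc⟩ := Metric.uniformContinuousOn_iff.mp huc η hη
  obtain ⟨r, hr, hr1⟩ := exists_between (show max 0 (1 - d) < 1 by simp [hd])
  obtain ⟨hr0, hrd⟩ := max_lt_iff.mp hr
  have hdil : ∀ z ∈ L, ‖f (r * z) - f z‖ < η := by
    intro z hz
    have hzρ := hLρ z hz
    rw [← dist_eq_norm]
    apply huc
    · rw [mem_closedBall_zero_iff, norm_mul, norm_real, Real.norm_of_nonneg hr0.le]
      nlinarith [norm_nonneg z]
    · rwa [mem_closedBall_zero_iff]
    · have h : (r : ℂ) * z - z = ((r - 1 : ℝ) : ℂ) * z := by push_cast; ring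
      rw [dist_eq_norm, h, norm_mul, norm_real, Real.norm_eq_abs, abs_sub_comm,
        abs_of_pos (by linarith)]
      nlinarith [norm_nonneg z]
  obtain ⟨r', hrr', hr'1⟩ := exists_between hr1
  obtain ⟨R, hr'R, hR1⟩ := exists_between hr'1
  lift r' to NNReal using (hr0.trans hrr').le
  lift R to NNReal using ((hr0.trans hrr').trans hr'R).le
  have hps := (hf.mono (closedBall_subset_ball hR1)).hasFPowerSeriesOnBall
    (show 0 < R from lt_of_le_of_lt zero_le (NNReal.coe_lt_coe.mp hr'R))
  have htu := hps.tendstoUniformlyOn (r' := r')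
    (by exact_mod_cast hr'R)
  obtain ⟨n, hn⟩ := (Metric.tendstoUniformlyOn_iff.mp htu η hη).exists
  set p := cauchyPowerSeries f 0 R
  set q : ℂ[X] := ∑ k ∈ Finset.range n, C (p.coeff k) * X ^ k with hq_def
  have hq : ∀ z : ℂ, ‖z‖ ≤ 1 → ‖q.eval (r * z) - f (r * z)‖ < η := by
    intro z hz
    have hmem : (r * z : ℂ) ∈ ball (0 : ℂ) r' := by
      rw [mem_ball_zero_iff, norm_mul, norm_real, Real.norm_of_nonneg hr0.le]
      nlinarith [norm_nonneg z]
    have h := hn _ hmem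
    rw [dist_comm, dist_eq_norm, zero_add] at h
    have hqp : q.eval (r * z) = p.partialSum n (r * z) := by
      rw [hq_def, FormalMultilinearSeries.partialSum, eval_finsetSum]
      refine Finset.sum_congr rfl fun k _ => ?_
      rw [FormalMultilinearSeries.apply_eq_pow_smul_coeff, eval_mul, eval_C, eval_pow, eval_X,
        smul_eq_mul, mul_comm]
    rwa [hqp]
  have hqb : ∀ z : ℂ, ‖z‖ ≤ 1 → ‖q.eval (r * z)‖ ≤ 1 + η := by
    intro z hz
    have h2 : ‖f (r * z)‖ ≤ 1 := hfb _ (by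
      rw [mem_ball_zero_iff, norm_mul, norm_real, Real.norm_of_nonneg hr0.le]
      nlinarith [norm_nonneg z])
    calc _ = ‖(q.eval (r * z) - f (r * z)) + f (r * z)‖ := by rw [sub_add_cancel]
      _ ≤ _ := norm_add_le _ _
      _ ≤ _ := by linarith [hq z hz]
  refine ⟨C ((1 - 2 * η : ℝ) : ℂ) * q.comp (C (r : ℂ) * X), ⟨1 - η, by linarith, ?_⟩, ?_⟩
  · intro z hz
    have h : (1 - 2 * η) * ‖q.eval (r * z)‖ ≤ (1 - 2 * η) * (1 + η) :=
      mul_le_mul_of_nonneg_left (hqb z hz) (by linarith)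
    simp only [eval_mul, eval_C, eval_comp, eval_X, norm_mul, norm_real]
    rw [Real.norm_of_nonneg (by linarith)]
    nlinarith
  · intro z hz
    have hz1 : ‖z‖ ≤ 1 := (hLρ z hz).trans hρ1.le
    have h : ‖((2 * η : ℝ) : ℂ) * q.eval (r * z)‖ ≤ 2 * η * (1 + η) := by
      rw [norm_mul, norm_real, Real.norm_of_nonneg (by linarith)]
      exact mul_le_mul_of_nonneg_left (hqb z hz1) (by linarith)
    simp only [eval_mul, eval_C, eval_comp, eval_X]
    calc _ = ‖(q.eval (r * z) - f (r * z)) + (f (r * z) - f z)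
          - ((2 * η : ℝ) : ℂ) * q.eval (r * z)‖ := by congr 1; push_cast; ring
      _ ≤ ‖q.eval (r * z) - f (r * z)‖ + ‖f (r * z) - f z‖
          + ‖((2 * η : ℝ) : ℂ) * q.eval (r * z)‖ :=
        (norm_sub_le _ _).trans (add_le_add_left (norm_add_le _ _) _)
      _ < ε := by nlinarith [hq z hz1, hdil z hz]

/-- **Carathéodory's theorem**: holomorphic functions bounded by one are locally uniform limits
of finite Blaschke products. -/
lemma exists_blaschkeProd_approx {L : Set ℂ} (hLc : IsCompact L) (hLD : L ⊆ ball (0:ℂ) 1)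
    {f : ℂ → ℂ} (hf : DifferentiableOn ℂ f (ball (0:ℂ) 1))
    (hfb : ∀ z ∈ ball (0:ℂ) 1, ‖f z‖ ≤ 1) {ε : ℝ} (hε : 0 < ε) :
    ∃ s : Multiset ℂ, s ≠ 0 ∧ (∀ w ∈ s, ‖w‖ < 1) ∧ ∀ z ∈ L, ‖blaschkeProd s z - f z‖ < ε := by
  obtain ⟨G, ⟨c, hc1, hGc⟩, hGL⟩ := exists_polynomial_approx hLc hLD hf hfb (half_pos hε)
  obtain ⟨ρ, hρ0, hρ1, hLρ⟩ : ∃ ρ : ℝ, 0 < ρ ∧ ρ < 1 ∧ ∀ z ∈ L, ‖z‖ ≤ ρ := by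
    obtain ⟨ρ, hρ, h⟩ := exists_pos_lt_subset_ball one_pos hLc.isClosed hLD
    exact ⟨ρ, hρ.1, hρ.2, fun z hz => (mem_ball_zero_iff.mp (h hz)).le⟩
  set n := G.natDegree + 1 with hn
  set H : ℂ → ℂ := fun z => ∑ j ∈ Finset.range n, conj (G.coeff j) * z ^ (n - j) with hH
  have hHinv : ∀ z : ℂ, z ≠ 0 → H z = z ^ n * conj (G.eval (conj z)⁻¹) := by
    intro z hz
    rw [hH, eval_eq_sum_range' (Nat.lt_succ_self _), map_sum, Finset.mul_sum]
    refine Finset.sum_congr rfl fun j hj => ?_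
    have hj' : j ≤ n := (Finset.mem_range.mp hj).le
    simp only [map_mul, map_pow, map_inv₀, conj_conj]
    rw [pow_sub₀ z hz hj', inv_pow]
    ring
  have hHc : ∀ z : ℂ, ‖z‖ ≤ 1 → ‖H z‖ ≤ c := by
    intro z hz
    refine norm_le_of_forall_mem_frontier_norm_le (U := ball (0:ℂ) 1) isBounded_ball
      (Differentiable.diffContOnCl (by fun_prop)) (fun w hw => ?_) ?_
    · rw [frontier_ball 0 one_ne_zero, mem_sphere_zero_iff_norm] at hw
      rw [hHinv w (norm_ne_zero_iff.mp (by simp [hw])), norm_mul, norm_pow, hw, one_pow, one_mul,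
        RCLike.norm_conj]
      exact hGc _ (by simp [hw])
    · rwa [closure_ball 0 one_ne_zero, mem_closedBall_zero_iff]
  obtain ⟨M, hM⟩ := exists_pow_lt_of_lt_one (show 0 < min (ε / 8) (1 / 2) by positivity) hρ1
  obtain ⟨hM1, hM2⟩ := lt_min_iff.mp hM
  set P : ℂ[X] := X ^ (n + M) + G with hP
  have hdeg : G.degree < (n + M : ℕ) :=
    G.degree_le_natDegree.trans_lt (by exact_mod_cast (by omega : G.natDegree < n + M))
  have hPm : P.Monic := monic_X_pow_add hdeg
  have hPs : P.Splits := IsAlgClosed.splits P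
  have hPdeg : P.natDegree = n + M := by
    rw [hP, natDegree_add_eq_left_of_degree_lt (by simpa using hdeg), natDegree_X_pow]
  have hPcard : P.roots.card = n + M := by rw [← hPs.natDegree_eq_card_roots, hPdeg]
  have hPev : ∀ z, P.eval z = (P.roots.map (z - ·)).prod :=
    fun z => hPs.eval_eq_prod_roots_of_monic hPm z
  have hden : ∀ z : ℂ, (P.roots.map fun w => 1 - conj w * z).prod = 1 + z ^ M * H z := by
    intro z
    rcases eq_or_ne z 0 with rfl | hz
    · have : H 0 = 0 := Finset.sum_eq_zero fun j hj => by
        rw [zero_pow (Nat.sub_ne_zero_of_lt (Finset.mem_range.mp hj)), mul_zero]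
      simp [this]
    · have h1 : z ^ (n + M) * conj (P.eval (conj z)⁻¹) = 1 + z ^ M * H z := by
        rw [hHinv z hz, hP]
        simp only [eval_add, eval_pow, eval_X, map_add, map_pow, map_inv₀, conj_conj]
        rw [mul_add, ← mul_pow, mul_inv_cancel₀ hz, one_pow]
        ring
      rw [← h1, hPev, ← hPcard, map_multiset_prod, Multiset.map_map]
      have h2 : z ^ P.roots.card = (P.roots.map fun _ => z).prod := by simp
      rw [h2, ← Multiset.prod_map_mul]
      congr 1
      refine Multiset.map_congr rfl fun w _ => ?_
      simp only [Function.comp, map_sub, map_inv₀, conj_conj]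
      rw [mul_sub, mul_inv_cancel₀ hz, mul_comm z]
  have hroots : ∀ w ∈ P.roots, ‖w‖ < 1 := by
    intro w hw
    by_contra! hw1
    have hw0 : conj w ≠ 0 := by
      rw [← norm_ne_zero_iff, RCLike.norm_conj]; linarith
    have hn1 : ‖(conj w)⁻¹‖ ≤ 1 := by
      rw [norm_inv, RCLike.norm_conj]; exact inv_le_one_of_one_le₀ hw1
    have h0 : (P.roots.map fun v => 1 - conj v * (conj w)⁻¹).prod = 0 :=
      Multiset.prod_eq_zero (Multiset.mem_map.mpr ⟨w, hw, by rw [mul_inv_cancel₀ hw0, sub_self]⟩)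
    rw [hden] at h0
    have h1 : ‖(conj w)⁻¹ ^ M * H (conj w)⁻¹‖ = 1 := by
      rw [eq_neg_of_add_eq_zero_right h0, norm_neg, norm_one]
    rw [norm_mul, norm_pow] at h1
    have := pow_le_one₀ (n := M) (norm_nonneg _) hn1
    nlinarith [hHc _ hn1, norm_nonneg (H (conj w)⁻¹), pow_nonneg (norm_nonneg (conj w)⁻¹) M]
  refine ⟨P.roots, ?_, hroots, fun z hz => ?_⟩
  · rw [← Multiset.card_pos, hPcard]; omega
  · have hzρ := hLρ z hz
    have hz1 : ‖z‖ ≤ 1 := hzρ.trans hρ1.le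
    have hzM : ‖z‖ ^ M ≤ ρ ^ M := pow_le_pow_left₀ (norm_nonneg z) hzρ M
    have ha : ‖z ^ M * H z‖ ≤ ρ ^ M := by
      rw [norm_mul, norm_pow]
      nlinarith [hHc z hz1, norm_nonneg (H z), pow_nonneg (norm_nonneg z) M]
    have hb : ‖z ^ (n + M)‖ ≤ ρ ^ M := by
      rw [pow_add, norm_mul, norm_pow, norm_pow]
      nlinarith [pow_le_one₀ (n := n) (norm_nonneg _) hz1, pow_nonneg (norm_nonneg z) M]
    have hD : 1 / 2 ≤ ‖1 + z ^ M * H z‖ := by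
      have := norm_sub_norm_le (1 : ℂ) (-(z ^ M * H z))
      rw [sub_neg_eq_add, norm_neg, norm_one] at this
      linarith
    have hD0 : 1 + z ^ M * H z ≠ 0 := norm_pos_iff.mp (by linarith)
    have hB : blaschkeProd P.roots z - G.eval z
        = (z ^ (n + M) - G.eval z * (z ^ M * H z)) / (1 + z ^ M * H z) := by
      rw [blaschkeProd, Multiset.prod_map_div, hden, ← hPev, hP]
      simp only [eval_add, eval_pow, eval_X]
      field_simp
      ring
    have hBn : ‖blaschkeProd P.roots z - G.eval z‖ ≤ 4 * ρ ^ M := by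
      rw [hB, norm_div, div_le_iff₀ (by linarith)]
      have h1 : ‖G.eval z * (z ^ M * H z)‖ ≤ ρ ^ M := by
        rw [norm_mul]
        nlinarith [hGc z hz1, norm_nonneg (G.eval z), norm_nonneg (z ^ M * H z)]
      have h2 := norm_sub_le (z ^ (n + M)) (G.eval z * (z ^ M * H z))
      nlinarith [pow_nonneg hρ0.le M]
    have := norm_sub_le_norm_sub_add_norm_sub (blaschkeProd P.roots z) (G.eval z) (f z)
    linarith [hGL z hz]

/-- The finite Blaschke product of the upper half-plane with zeros `s`, normalised at infinity. -/
def halfPlaneProd (s : Multiset ℂ) (x : ℂ) : ℂ :=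
  (s.map fun ρ => (x - ρ) / (x - conj ρ)).prod

lemma halfPlaneProd_add (s t : Multiset ℂ) (x : ℂ) :
    halfPlaneProd (s + t) x = halfPlaneProd s x * halfPlaneProd t x := by
  simp [halfPlaneProd]

/-- Partial fractions of a product with interlacing zeros and poles. -/
lemma exists_prod_sub_div_eq (F : Finset ℤ) {l : ℝ} (hl0 : 0 < l) (hl1 : l < 1) :
    ∃ m : ℤ → ℝ, (∀ k ∈ F, 0 < m k) ∧ ∀ u : ℂ, (∀ k ∈ F, u ≠ k) →
      ∏ k ∈ F, (u - k - l) / (u - k) = 1 - ∑ k ∈ F, m k / (u - k) := by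
  refine ⟨fun k => l * ∏ j ∈ F.erase k, (1 - l / ((k : ℝ) - j)), fun k _ => ?_, fun u hu => ?_⟩
  · refine mul_pos hl0 (Finset.prod_pos fun j hj => ?_)
    have hjk : k ≠ j := (Finset.ne_of_mem_erase hj).symm
    rw [sub_pos]
    rcases lt_or_gt_of_ne hjk with h | h
    · have : (k : ℝ) - j < 0 := sub_neg.mpr (by exact_mod_cast h)
      exact (div_neg_of_pos_of_neg hl0 this).trans one_pos
    · have : (j : ℝ) + 1 ≤ k := by exact_mod_cast h
      rw [div_lt_one (by linarith)]
      linarith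
  · set D : ℂ[X] := Lagrange.nodal F (fun k : ℤ => (k : ℂ)) with hD
    set N : ℂ[X] := Lagrange.nodal F (fun k : ℤ => (k : ℂ) + l) with hN
    have hdeg : (N - D).degree < F.card := by
      rw [← Lagrange.degree_nodal (s := F) (v := fun k : ℤ => (k : ℂ) + l)]
      refine degree_sub_lt_left ?_ Lagrange.nodal_ne_zero ?_
      · rw [hN, hD, Lagrange.degree_nodal, Lagrange.degree_nodal]
      · rw [hN, hD, Lagrange.nodal_monic.leadingCoeff, Lagrange.nodal_monic.leadingCoeff]
    have hinterp := Lagrange.eq_interpolate (s := F) (v := fun k : ℤ => (k : ℂ))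
      (Int.cast_injective.injOn) hdeg
    have hev := congrArg (eval u) hinterp
    rw [Lagrange.eval_interpolate_not_at_node _ hu, eval_sub] at hev
    have hDu : D.eval u ≠ 0 := by
      rw [hD, Lagrange.eval_nodal]
      exact Finset.prod_ne_zero_iff.mpr fun k hk => sub_ne_zero.mpr (hu k hk)
    have hR : ∏ k ∈ F, (u - k - l) / (u - k) = N.eval u / D.eval u := by
      rw [hN, hD, Lagrange.eval_nodal, Lagrange.eval_nodal, ← Finset.prod_div_distrib]
      simp only [sub_sub]
    have hS : N.eval u / D.eval u = 1 + (N.eval u - D.eval u) / D.eval u := by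
      field_simp
      ring
    rw [hR, hS, hev, mul_div_cancel_left₀ _ hDu, sub_eq_add_neg (1 : ℂ), ← Finset.sum_neg_distrib]
    congr 1
    refine Finset.sum_congr rfl fun k hk => ?_
    rw [Lagrange.nodalWeight, eval_sub, hD, Lagrange.eval_nodal_at_node hk, sub_zero, hN,
      Lagrange.eval_nodal, ← Finset.mul_prod_erase F _ hk]
    have h1 : ∏ j ∈ F.erase k, ((k : ℂ) - (j + l)) =
        (∏ j ∈ F.erase k, ((k : ℂ) - j)) * ∏ j ∈ F.erase k, (1 - l / ((k : ℂ) - j)) := by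
      rw [← Finset.prod_mul_distrib]
      refine Finset.prod_congr rfl fun j hj => ?_
      have : (k : ℂ) - j ≠ 0 := by
        rw [sub_ne_zero]; exact_mod_cast (Finset.ne_of_mem_erase hj).symm
      field_simp
      ring
    have h2 : ∏ j ∈ F.erase k, ((k : ℂ) - j) ≠ 0 := by
      refine Finset.prod_ne_zero_iff.mpr fun j hj => ?_
      rw [sub_ne_zero]; exact_mod_cast (Finset.ne_of_mem_erase hj).symm
    rw [h1, Finset.prod_inv_distrib]
    push_cast
    field_simp
    ring

lemma exists_halfPlaneProd_eq (F : Finset ℤ) {l : ℝ} (hl0 : 0 < l) (hl1 : l < 1) {a : ℝ}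
    (ha : 0 < a) {τ : ℂ} (hτ : 0 < τ.im) :
    ∃ s : Multiset ℂ, (∀ ρ ∈ s, 0 < ρ.im) ∧ ∀ u : ℂ, (∀ k ∈ F, u ≠ k) →
      halfPlaneProd s u =
        (1 - conj τ * (a * (∏ k ∈ F, (u - k - l) / (u - k) - 1))) /
          (1 - τ * (a * (∏ k ∈ F, (u - k - l) / (u - k) - 1))) := by
  obtain ⟨m, hm, hR⟩ := exists_prod_sub_div_eq F hl0 hl1
  have hτ0 : τ ≠ 0 := by rintro rfl; simp at hτ
  have ha0 : (a : ℂ) ≠ 0 := ofReal_ne_zero.mpr ha.ne'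
  set D : ℂ[X] := Lagrange.nodal F (fun k : ℤ => (k : ℂ)) with hD
  set N : ℂ[X] := Lagrange.nodal F (fun k : ℤ => (k : ℂ) + l) with hN
  set Q : ℂ[X] := D - C (a * conj τ) * (N - D) with hQ
  have hdeg : (N - D).degree < D.degree := by
    have h : N.degree = D.degree := by rw [hN, hD, Lagrange.degree_nodal, Lagrange.degree_nodal]
    rw [← h]
    refine degree_sub_lt_left h Lagrange.nodal_ne_zero ?_
    rw [hN, hD, Lagrange.nodal_monic.leadingCoeff, Lagrange.nodal_monic.leadingCoeff]
  have hQm : Q.Monic := Lagrange.nodal_monic.sub_of_left (by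
    rw [degree_C_mul (mul_ne_zero ha0 (by simpa using hτ0))]
    exact hdeg)
  have hQs : Q.Splits := IsAlgClosed.splits Q
  have hQev : ∀ u, (Q.roots.map (u - ·)).prod = Q.eval u :=
    fun u => (hQs.eval_eq_prod_roots_of_monic hQm u).symm
  have hDev : ∀ u, D.eval u = ∏ k ∈ F, (u - k) := fun u => Lagrange.eval_nodal
  have hNev : ∀ u, N.eval u = ∏ k ∈ F, (u - k - l) := fun u => by
    rw [hN, Lagrange.eval_nodal]; simp only [sub_sub]
  have hQu : ∀ u, Q.eval u = D.eval u - a * conj τ * (N.eval u - D.eval u) := fun u => by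
    simp [hQ]
  have hDne : ∀ u : ℂ, (∀ k ∈ F, u ≠ k) → D.eval u ≠ 0 := fun u hu => by
    rw [hDev]; exact Finset.prod_ne_zero_iff.mpr fun k hk => sub_ne_zero.mpr (hu k hk)
  have hND : ∀ u : ℂ, (∀ k ∈ F, u ≠ k) →
      N.eval u = D.eval u * ∏ k ∈ F, (u - k - l) / (u - k) := fun u hu => by
    rw [Finset.prod_div_distrib, ← hNev, ← hDev, mul_div_cancel₀ _ (hDne u hu)]
  have hQf : ∀ u : ℂ, (∀ k ∈ F, u ≠ k) → Q.eval u =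
      D.eval u * (1 - conj τ * (a * (∏ k ∈ F, (u - k - l) / (u - k) - 1))) := fun u hu => by
    rw [hQu, hND u hu]; ring
  have hQc : ∀ u : ℂ, (∀ k ∈ F, u ≠ k) → (Q.roots.map (u - conj ·)).prod =
      D.eval u * (1 - τ * (a * (∏ k ∈ F, (u - k - l) / (u - k) - 1))) := fun u hu => by
    have hu' : ∀ k ∈ F, conj u ≠ k := fun k hk h => hu k hk (by
      rw [← conj_conj u, h]; simp)
    have h : conj (Q.eval (conj u)) = (Q.roots.map (u - conj ·)).prod := by
      rw [← hQev, map_multiset_prod, Multiset.map_map]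
      simp
    rw [← h, hQf _ hu', hDev, hDev]
    simp [map_prod]
  refine ⟨Q.roots, fun ρ hρ => ?_, fun u hu => ?_⟩
  · have h0 : Q.eval ρ = 0 := (mem_roots'.mp hρ).2
    have hρF : ∀ k ∈ F, ρ ≠ k := by
      rintro k hk rfl
      have hDk : D.eval (k : ℂ) = 0 := by
        rw [hDev]; exact Finset.prod_eq_zero hk (sub_self _)
      rw [hQu, hDk] at h0
      have hNk : N.eval (k : ℂ) = 0 := by simpa [ha0, hτ0] using h0
      rw [hNev, Finset.prod_eq_zero_iff] at hNk
      obtain ⟨j, -, hj⟩ := hNk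
      have hj' : ((k - j : ℤ) : ℝ) = l := by
        have : (((k - j : ℤ) : ℝ) : ℂ) = l := by push_cast; exact sub_eq_zero.mp hj
        exact_mod_cast this
      rw [← hj'] at hl0 hl1
      have h1 : 0 < k - j := by exact_mod_cast hl0
      have h2 : k - j < 1 := by exact_mod_cast hl1
      omega
    have h1 : 1 - conj τ * (a * (∏ k ∈ F, (ρ - k - l) / (ρ - k) - 1)) = 0 :=
      (mul_eq_zero.mp ((hQf ρ hρF).symm.trans h0)).resolve_left (hDne ρ hρF)
    rw [hR ρ hρF] at h1
    have h2 : (a : ℂ) * ∑ k ∈ F, m k / (ρ - k) = - (conj τ)⁻¹ := by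
      have hc : conj τ ≠ 0 := by simpa using hτ0
      field_simp
      linear_combination h1
    have h3 := congrArg im h2
    rw [im_ofReal_mul, im_sum, neg_im, inv_im, conj_im, neg_neg] at h3
    have h4 : ∀ k ∈ F, ((m k : ℂ) / (ρ - k)).im = - (ρ.im * (m k / normSq (ρ - k))) := by
      intro k _
      rw [div_eq_mul_inv, im_ofReal_mul, inv_im]
      simp
      ring
    rw [Finset.sum_congr rfl h4, Finset.sum_neg_distrib, ← Finset.mul_sum] at h3
    have h5 : 0 ≤ ∑ k ∈ F, m k / normSq (ρ - k) :=
      Finset.sum_nonneg fun k hk => div_nonneg (hm k hk).le (normSq_nonneg _)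
    have h6 : 0 < τ.im / normSq (conj τ) :=
      div_pos hτ (normSq_pos.mpr (by simpa using hτ0))
    have h7 : a * (ρ.im * ∑ k ∈ F, m k / normSq (ρ - k)) = τ.im / normSq (conj τ) := by
      linarith
    rw [← h7] at h6
    exact pos_of_mul_pos_left (pos_of_mul_pos_right h6 ha.le) h5
  · rw [halfPlaneProd, Multiset.prod_map_div, hQev, hQc u hu, hQf u hu,
      mul_div_mul_left _ _ (hDne u hu)]

lemma exists_shift_lattice_disjoint {K : Set ℝ} (hK : volume K = 0) (h : ℝ) :
    ∃ σ : ℝ, ∀ t ∈ K, ∀ k : ℤ, t ≠ σ + k * h := by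
  have h0 : volume (⋃ k : ℤ, (· + (k * h : ℝ)) ⁻¹' K) = 0 :=
    measure_iUnion_null fun k => by rw [measure_preimage_add_right, hK]
  obtain ⟨σ, hσ⟩ : (⋃ k : ℤ, (· + (k * h : ℝ)) ⁻¹' K)ᶜ.Nonempty := by
    rw [nonempty_compl]
    intro hu
    rw [hu, Real.volume_univ] at h0
    exact ENNReal.top_ne_zero h0
  exact ⟨σ, fun t ht k hk => hσ (mem_iUnion.mpr ⟨k, by rwa [mem_preimage, ← hk]⟩)⟩

lemma finite_image_floor {K : Set ℝ} (hK : IsCompact K) (σ : ℝ) {h : ℝ} (hh : 0 < h) :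
    ((fun t => ⌊(t - σ) / h⌋) '' K).Finite := by
  obtain ⟨a, ha⟩ := hK.bddBelow
  obtain ⟨b, hb⟩ := hK.bddAbove
  refine (Set.finite_Icc ⌊(a - σ) / h⌋ ⌊(b - σ) / h⌋).subset ?_
  rintro _ ⟨t, ht, rfl⟩
  have h1 := ha ht
  have h2 := hb ht
  exact ⟨Int.floor_mono (by gcongr), Int.floor_mono (by gcongr)⟩

lemma card_mul_le_volume_cthickening {K : Set ℝ} {σ h : ℝ} (hh : 0 < h) {F : Finset ℤ}
    (hF : ∀ k ∈ F, ∃ t ∈ K, ⌊(t - σ) / h⌋ = k) :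
    ENNReal.ofReal (F.card * h) ≤ volume (cthickening h K) := by
  have hfl : ∀ (x : ℝ) (k : ℤ), ⌊(x - σ) / h⌋ = k ↔ x ∈ Ico (σ + k * h) (σ + (k + 1) * h) := by
    intro x k
    rw [Int.floor_eq_iff, le_div_iff₀ hh, div_lt_iff₀ hh, mem_Ico]
    constructor <;> rintro ⟨h1, h2⟩ <;> constructor <;> linarith
  calc ENNReal.ofReal (F.card * h)
      = ∑ k ∈ F, volume (Ico (σ + k * h) (σ + (k + 1) * h)) := by
        simp_rw [Real.volume_Ico]
        rw [Finset.sum_congr rfl fun k _ => by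
          rw [show σ + ((k : ℝ) + 1) * h - (σ + k * h) = h by ring], Finset.sum_const,
          nsmul_eq_mul, ENNReal.ofReal_mul (by positivity), ENNReal.ofReal_natCast]
    _ = volume (⋃ k ∈ F, Ico (σ + k * h) (σ + (k + 1) * h)) := by
        refine (measure_biUnion_finset ?_ fun k _ => measurableSet_Ico).symm
        intro j _ k _ hjk
        refine Set.disjoint_left.mpr fun x hj hk => hjk ?_
        rw [← (hfl x j).mpr hj, ← (hfl x k).mpr hk]
    _ ≤ _ := by
        refine measure_mono (iUnion₂_subset fun k hk x hx => ?_)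
        obtain ⟨t, ht, htk⟩ := hF k hk
        have ht' := (hfl t k).mp htk
        refine mem_cthickening_of_dist_le x t h K ht ?_
        rw [Real.dist_eq, abs_le]
        constructor <;> linarith [hx.1, hx.2, ht'.1, ht'.2]

lemma exists_fract_lt {K : Set ℝ} (hKc : IsCompact K) {σ h : ℝ}
    (hσ : ∀ t ∈ K, ∀ k : ℤ, (t - σ) / h ≠ k) :
    ∃ l : ℝ, 0 < l ∧ l < 1 ∧ ∀ t ∈ K, Int.fract ((t - σ) / h) < l := by
  rcases K.eq_empty_or_nonempty with rfl | hne
  · exact ⟨1 / 2, by norm_num, by norm_num, by simp⟩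
  · have hc : ContinuousOn (fun t => Int.fract ((t - σ) / h)) K := fun t ht =>
      (ContinuousAt.comp (f := fun t => (t - σ) / h) (continuousAt_fract (hσ t ht _))
        (by fun_prop)).continuousWithinAt
    obtain ⟨t₀, -, hmax⟩ := hKc.exists_isMaxOn hne hc
    obtain ⟨l, hl, hl1⟩ := exists_between (Int.fract_lt_one ((t₀ - σ) / h))
    exact ⟨l, (Int.fract_nonneg _).trans_lt hl, hl1, fun t ht => (hmax ht).trans_lt hl⟩

lemma prod_sub_div_neg {F : Finset ℤ} {l u : ℝ} (hl1 : l < 1) (hF : ⌊u⌋ ∈ F)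
    (hu0 : u ≠ ⌊u⌋) (hul : Int.fract u < l) : ∏ k ∈ F, (u - k - l) / (u - k) < 0 := by
  have h1 : (⌊u⌋ : ℝ) < u := lt_of_le_of_ne (Int.floor_le u) hu0.symm
  have h2 := Int.lt_floor_add_one u
  rw [Int.fract] at hul
  rw [← Finset.mul_prod_erase F _ hF]
  refine mul_neg_of_neg_of_pos (div_neg_of_neg_of_pos (by linarith) (by linarith))
    (Finset.prod_pos fun k hk => ?_)
  rcases lt_or_gt_of_ne (Finset.ne_of_mem_erase hk) with h | h
  · have : (k : ℝ) + 1 ≤ ⌊u⌋ := by exact_mod_cast h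
    exact div_pos (by linarith) (by linarith)
  · have : (⌊u⌋ : ℝ) + 1 ≤ k := by exact_mod_cast h
    exact div_pos_of_neg_of_neg (by linarith) (by linarith)

lemma exists_upperHalfPlane_conj_sq {c : ℂ} (hc : ‖c‖ = 1) (hc1 : c ≠ 1) :
    ∃ τ : ℂ, ‖τ‖ = 1 ∧ 0 < τ.im ∧ conj τ ^ 2 = c := by
  have key : ∀ β : ℝ, conj (exp (β * I)) ^ 2 = exp ((-2 * β : ℝ) * I) := by
    intro β
    rw [← exp_conj, ← exp_nat_mul]
    congr 1
    simp
    ring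
  have hce : exp (arg c * I) = c := by
    have := norm_mul_exp_arg_mul_I c
    rwa [hc, ofReal_one, one_mul] at this
  have harg : arg c ≠ 0 := fun h => hc1 (by rw [← hce, h]; simp)
  rcases lt_or_gt_of_ne harg with h | h
  · refine ⟨exp ((-arg c / 2 : ℝ) * I), norm_exp_ofReal_mul_I _, ?_, ?_⟩
    · rw [exp_ofReal_mul_I_im]
      exact Real.sin_pos_of_pos_of_lt_pi (by linarith)
        (by linarith [neg_pi_lt_arg c, Real.pi_pos])
    · rw [key, show -2 * (-arg c / 2) = arg c by ring, hce]
  · refine ⟨exp ((Real.pi - arg c / 2 : ℝ) * I), norm_exp_ofReal_mul_I _, ?_, ?_⟩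
    · rw [exp_ofReal_mul_I_im]
      exact Real.sin_pos_of_pos_of_lt_pi (by linarith [arg_le_pi c, Real.pi_pos]) (by linarith)
    · rw [key, show ((-2 * (Real.pi - arg c / 2) : ℝ) : ℂ) * I = arg c * I - 2 * Real.pi * I by
        push_cast; ring, exp_sub, hce, exp_two_pi_mul_I, div_one]

lemma halfPlaneProd_affine (s : Multiset ℂ) (σ : ℝ) {h : ℝ} (hh : h ≠ 0) (x : ℂ) :
    halfPlaneProd (s.map fun ρ => (σ : ℂ) + h * ρ) x = halfPlaneProd s ((x - σ) / h) := by
  rw [halfPlaneProd, halfPlaneProd, Multiset.map_map]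
  congr 1
  refine Multiset.map_congr rfl fun ρ _ => ?_
  have hh' : (h : ℂ) ≠ 0 := ofReal_ne_zero.mpr hh
  simp only [Function.comp, map_add, map_mul, conj_ofReal]
  rw [show x - (σ + h * ρ) = h * ((x - σ) / h - ρ) by field_simp; ring,
    show x - (σ + h * conj ρ) = h * ((x - σ) / h - conj ρ) by field_simp; ring,
    mul_div_mul_left _ _ hh']

lemma norm_mobius_sub_one_le {τ T : ℂ} (hτ : ‖τ‖ = 1) (hT : ‖T‖ ≤ 1 / 2) :
    ‖(1 - conj τ * T) / (1 - τ * T) - 1‖ ≤ 4 * ‖T‖ := by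
  have hd : 1 / 2 ≤ ‖1 - τ * T‖ := by
    have := norm_sub_norm_le (1 : ℂ) (τ * T)
    rw [norm_one, norm_mul, hτ, one_mul] at this
    linarith
  have hd0 : 1 - τ * T ≠ 0 := norm_pos_iff.mp (by linarith)
  rw [show (1 - conj τ * T) / (1 - τ * T) - 1 = (τ - conj τ) * T / (1 - τ * T) by
    rw [div_sub_one hd0]; congr 1; ring, norm_div, norm_mul, div_le_iff₀ (by linarith)]
  have h2 : ‖τ - conj τ‖ ≤ 2 := by
    have := norm_sub_le τ (conj τ)
    rw [RCLike.norm_conj, hτ] at this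
    linarith
  nlinarith [norm_nonneg T, mul_le_mul_of_nonneg_right h2 (norm_nonneg T)]

lemma norm_mobius_sub_conj_sq_le {τ T : ℂ} (hτ : ‖τ‖ = 1) (hT : 1 < ‖T‖) :
    ‖(1 - conj τ * T) / (1 - τ * T) - conj τ ^ 2‖ ≤ 2 / (‖T‖ - 1) := by
  have hd : ‖T‖ - 1 ≤ ‖1 - τ * T‖ := by
    have := norm_sub_norm_le (τ * T) 1
    rw [norm_one, norm_mul, hτ, one_mul, norm_sub_rev] at this
    linarith
  have hd0 : 1 - τ * T ≠ 0 := norm_pos_iff.mp (by linarith)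
  have hττ : conj τ * τ = 1 := by
    rw [mul_comm, mul_conj, normSq_eq_norm_sq, hτ]; simp
  have h1 : (1 - conj τ * T) / (1 - τ * T) - conj τ ^ 2 = (1 - conj τ ^ 2) / (1 - τ * T) := by
    rw [div_sub' hd0]
    congr 1
    linear_combination T * conj τ * hττ
  rw [h1, norm_div]
  have h2 : ‖1 - conj τ ^ 2‖ ≤ 2 := by
    have := norm_sub_le 1 (conj τ ^ 2)
    rw [norm_pow, RCLike.norm_conj, hτ] at this
    norm_num at this
    linarith
  exact div_le_div₀ (by norm_num) h2 (by linarith) hd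

/-- A half-plane Blaschke product close to a unimodular constant on a null compact set and close
to one on a compact set disjoint from it. -/
lemma exists_halfPlaneProd_approx_const {K : Set ℝ} (hKc : IsCompact K) (hK0 : volume K = 0)
    {E : Set ℂ} (hE : IsCompact E) (hKE : ∀ x ∈ K, (x : ℂ) ∉ E) {c : ℂ} (hc : ‖c‖ = 1)
    {ε : ℝ} (hε : 0 < ε) :
    ∃ s : Multiset ℂ, (∀ ρ ∈ s, 0 < ρ.im) ∧ (∀ x ∈ K, ‖halfPlaneProd s x - c‖ < ε) ∧
      ∀ z ∈ E, ‖halfPlaneProd s z - 1‖ < ε := by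
  rcases eq_or_ne c 1 with rfl | hc1
  · exact ⟨0, by simp, by simp [halfPlaneProd, hε], by simp [halfPlaneProd, hε]⟩
  obtain ⟨τ, hτ, hτim, hτc⟩ := exists_upperHalfPlane_conj_sq hc hc1
  obtain ⟨r, hr, hKEr⟩ : ∃ r : ℝ, 0 < r ∧ ∀ z ∈ E, ∀ x ∈ K, r < ‖z - x‖ := by
    obtain ⟨r, hr, h⟩ := exists_pos_forall_lt_edist hE
      (hKc.image continuous_ofReal).isClosed
      (Set.disjoint_left.mpr fun z hz ⟨x, hx, hxz⟩ => hKE x hx (hxz ▸ hz))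
    refine ⟨r, by exact_mod_cast hr, fun z hz x hx => ?_⟩
    have := h z hz x ⟨x, hx, rfl⟩
    rw [edist_nndist, ENNReal.coe_lt_coe] at this
    rw [← dist_eq_norm, ← coe_nndist]
    exact_mod_cast this
  set a : ℝ := 2 + 4 / ε with ha
  have ha0 : 0 < a := by positivity
  set η : ℝ := min (1 / 2) (ε / 8) with hη
  have hη0 : 0 < η := by positivity
  set b : ℝ := Real.log (1 + η / a) with hb
  have hηa : 0 < η / a := by positivity
  have hb0 : 0 < b := Real.log_pos (by linarith)
  have hab : a * (Real.exp b - 1) = η := by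
    rw [hb, Real.exp_log (by linarith)]; field_simp; ring
  obtain ⟨h, hh, hhr, hvol⟩ : ∃ h : ℝ, 0 < h ∧ h < r / 2 ∧
      volume (cthickening h K) < ENNReal.ofReal (b * (r / 2)) := by
    have ht := tendsto_measure_cthickening_of_isCompact (μ := volume) hKc
    rw [hK0] at ht
    have h1 := (ht.eventually_lt_const
      (show 0 < ENNReal.ofReal (b * (r / 2)) by simp; positivity)).filter_mono
      (nhdsWithin_le_nhds (s := Ioi 0))
    obtain ⟨h, h1, h2⟩ := (h1.and (Ioo_mem_nhdsGT (show 0 < r / 2 by positivity))).exists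
    exact ⟨h, h2.1, h2.2, h1⟩
  obtain ⟨σ, hσ⟩ := exists_shift_lattice_disjoint hK0 h
  have hσ' : ∀ t ∈ K, ∀ k : ℤ, (t - σ) / h ≠ k := fun t ht k hk => hσ t ht k (by
    rw [div_eq_iff hh.ne'] at hk; linarith)
  obtain ⟨l, hl0, hl1, hl⟩ := exists_fract_lt hKc hσ'
  set F := (finite_image_floor hKc σ hh).toFinset with hF
  have hFK : ∀ k ∈ F, ∃ t ∈ K, ⌊(t - σ) / h⌋ = k := fun k hk => by simpa [hF] using hk
  have hcard : F.card * h < b * (r / 2) := by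
    refine (ENNReal.ofReal_lt_ofReal_iff (by positivity)).mp ?_
    exact (card_mul_le_volume_cthickening hh hFK).trans_lt hvol
  obtain ⟨s, hs, hsu⟩ := exists_halfPlaneProd_eq F hl0 hl1 ha0 hτim
  refine ⟨s.map fun ρ => (σ : ℂ) + h * ρ, ?_, fun x hx => ?_, fun z hz => ?_⟩
  · intro ρ hρ
    obtain ⟨ρ', hρ', rfl⟩ := Multiset.mem_map.mp hρ
    simpa using mul_pos hh (hs ρ' hρ')
  · rw [halfPlaneProd_affine _ _ hh.ne', ← hτc]
    set u : ℝ := (x - σ) / h with hu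
    have hucast : ((x : ℂ) - σ) / h = (u : ℂ) := by rw [hu]; push_cast; rfl
    rw [hucast, hsu _ fun k _ => by exact_mod_cast hσ' x hx k]
    have hneg := prod_sub_div_neg (F := F) hl1
      (by rw [hF, Set.Finite.mem_toFinset]; exact ⟨x, hx, rfl⟩) (hσ' x hx _) (hl x hx)
    set R : ℝ := ∏ k ∈ F, (u - k - l) / (u - k) with hR
    have hRc : ∏ k ∈ F, ((u : ℂ) - k - l) / (u - k) = (R : ℂ) := by rw [hR]; push_cast; rfl
    have hT : a < ‖(a : ℂ) * (R - 1)‖ := by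
      rw [← ofReal_one, ← ofReal_sub, ← ofReal_mul, norm_real, Real.norm_eq_abs,
        abs_of_neg (mul_neg_of_pos_of_neg ha0 (by linarith))]
      nlinarith
    rw [hRc]
    have h4 : 0 < 4 / ε := by positivity
    refine (norm_mobius_sub_conj_sq_le hτ (by linarith)).trans_lt ?_
    rw [div_lt_iff₀ (by linarith)]
    have h5 : ε * (4 / ε) = 4 := by field_simp
    nlinarith
  · rw [halfPlaneProd_affine _ _ hh.ne']
    have hdist : ∀ k ∈ F, r / 2 / h ≤ ‖(z - σ) / h - k‖ := by
      intro k hk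
      obtain ⟨t, ht, htk⟩ := hFK k hk
      rw [Int.floor_eq_iff, le_div_iff₀ hh, div_lt_iff₀ hh] at htk
      have h1 : ‖((t - (σ + k * h) : ℝ) : ℂ)‖ ≤ h := by
        rw [norm_real, Real.norm_eq_abs, abs_le]
        constructor <;> nlinarith
      have h2 : (z - σ) / h - k = ((z - t) + ((t - (σ + k * h) : ℝ) : ℂ)) / h := by
        have hh' : (h : ℂ) ≠ 0 := ofReal_ne_zero.mpr hh.ne'
        push_cast
        field_simp
        ring
      rw [h2, norm_div, norm_real, Real.norm_of_nonneg hh.le]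
      gcongr
      have h3 := norm_sub_norm_le (z - t) (-((t - (σ + k * h) : ℝ) : ℂ))
      rw [sub_neg_eq_add, norm_neg] at h3
      linarith [hKEr z hz t ht]
    have hpos : 0 < r / 2 / h := by positivity
    have hne : ∀ k ∈ F, (z - σ) / h ≠ k := fun k hk he => by
      have := hdist k hk
      rw [he, sub_self, norm_zero] at this
      linarith
    rw [hsu _ hne]
    set u : ℂ := (z - σ) / h with hu
    have hprod : ‖∏ k ∈ F, (u - k - l) / (u - k) - 1‖ ≤ Real.exp b - 1 := by
      have h1 : ∀ k ∈ F, (u - k - l) / (u - k) = 1 + -(l / (u - k)) := fun k hk => by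
        have := sub_ne_zero.mpr (hne k hk)
        field_simp
        ring
      rw [Finset.prod_congr rfl h1]
      refine (F.norm_prod_one_add_sub_one_le _).trans ?_
      gcongr
      calc ∑ k ∈ F, ‖-((l : ℂ) / (u - k))‖ ≤ ∑ k ∈ F, (1 / (r / 2 / h)) := by
            refine Finset.sum_le_sum fun k hk => ?_
            rw [norm_neg, norm_div, norm_real, Real.norm_of_nonneg hl0.le]
            exact div_le_div₀ zero_le_one hl1.le hpos (hdist k hk)
        _ = F.card * h / (r / 2) := by
            rw [Finset.sum_const, nsmul_eq_mul]; field_simp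
        _ ≤ b := by rw [div_le_iff₀ (by positivity)]; exact hcard.le
    have hT : ‖(a : ℂ) * (∏ k ∈ F, (u - k - l) / (u - k) - 1)‖ ≤ η := by
      rw [norm_mul, norm_real, Real.norm_of_nonneg ha0.le, ← hab]
      gcongr
    refine (norm_mobius_sub_one_le hτ (hT.trans (min_le_left _ _))).trans_lt ?_
    linarith [min_le_right (1 / 2) (ε / 8)]

lemma norm_halfPlaneProd_le_one {s : Multiset ℂ} (hs : ∀ ρ ∈ s, 0 < ρ.im) {x : ℂ}
    (hx : 0 ≤ x.im) : ‖halfPlaneProd s x‖ ≤ 1 := by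
  induction s using Multiset.induction_on with
  | empty => simp [halfPlaneProd]
  | cons ρ s ih =>
    have hρ := hs ρ (Multiset.mem_cons_self ρ s)
    rw [halfPlaneProd, Multiset.map_cons, Multiset.prod_cons, norm_mul]
    refine mul_le_one₀ ?_ (norm_nonneg _) (ih fun v hv => hs v (Multiset.mem_cons_of_mem hv))
    rw [norm_div]
    refine div_le_one_of_le₀ ?_ (norm_nonneg _)
    apply le_of_sq_le_sq _ (norm_nonneg _)
    rw [← normSq_eq_norm_sq, ← normSq_eq_norm_sq]
    simp only [normSq_apply, sub_re, sub_im, conj_re, conj_im]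
    nlinarith [mul_nonneg hx hρ.le]

lemma norm_mul_sub_mul_lt {a b v w : ℂ} (hb : ‖b‖ ≤ 1) (hv : ‖v‖ ≤ 1) {ε : ℝ}
    (ha : ‖a - v‖ < ε / 2) (hbw : ‖b - w‖ < ε / 2) : ‖a * b - v * w‖ < ε := by
  have h1 : a * b - v * w = (a - v) * b + v * (b - w) := by ring
  have h2 := norm_add_le ((a - v) * b) (v * (b - w))
  rw [← h1, norm_mul, norm_mul] at h2
  nlinarith [norm_nonneg (a - v), norm_nonneg (b - w)]

lemma exists_halfPlaneProd_approx_step {K : Set ℝ} (hKc : IsCompact K) (hK0 : volume K = 0)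
    {E : Set ℂ} (hE : IsCompact E) (hKE : ∀ x ∈ K, (x : ℂ) ∉ E) (hEim : ∀ z ∈ E, 0 ≤ z.im)
    {σ h : ℝ} (hh : 0 < h) (hσ : ∀ t ∈ K, ∀ k : ℤ, t ≠ σ + k * h) {c : ℤ → ℂ}
    (hc : ∀ k, ‖c k‖ = 1) (F : Finset ℤ) {ε : ℝ} (hε : 0 < ε) :
    ∃ s : Multiset ℂ, (∀ ρ ∈ s, 0 < ρ.im) ∧
      (∀ x ∈ K, ⌊(x - σ) / h⌋ ∈ F → ‖halfPlaneProd s x - c ⌊(x - σ) / h⌋‖ < ε) ∧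
      (∀ x ∈ K, ⌊(x - σ) / h⌋ ∉ F → ‖halfPlaneProd s x - 1‖ < ε) ∧
      ∀ z ∈ E, ‖halfPlaneProd s z - 1‖ < ε := by
  induction F using Finset.induction_on generalizing ε with
  | empty => exact ⟨0, by simp, by simp, by simp [halfPlaneProd, hε], by simp [halfPlaneProd, hε]⟩
  | insert k F hk ih =>
    have hfl : ∀ x, ⌊(x - σ) / h⌋ = k ↔ σ + k * h ≤ x ∧ x < σ + (k + 1) * h := by
      intro x
      rw [Int.floor_eq_iff, le_div_iff₀ hh, div_lt_iff₀ hh]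
      constructor <;> rintro ⟨h1, h2⟩ <;> constructor <;> linarith
    have hK1 : IsCompact {x ∈ K | ⌊(x - σ) / h⌋ = k} := by
      convert hKc.inter_right (isClosed_Icc (a := σ + k * h) (b := σ + (k + 1) * h)) using 1
      ext x
      simp only [mem_ofPred_eq, mem_inter_iff, mem_Icc, hfl]
      refine and_congr_right fun hx => and_congr_right fun _ => ⟨le_of_lt, fun hle => ?_⟩
      refine lt_of_le_of_ne hle ?_
      simpa using hσ x hx (k + 1)
    have hK2 : IsCompact {x ∈ K | ⌊(x - σ) / h⌋ ≠ k} := by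
      convert hKc.inter_right
        (isOpen_Ioo (a := σ + k * h) (b := σ + (k + 1) * h)).isClosed_compl using 1
      ext x
      simp only [mem_ofPred_eq, mem_inter_iff, mem_compl_iff, mem_Ioo, ne_eq, hfl]
      refine and_congr_right fun hx => not_congr (and_congr_left fun _ => ?_)
      exact ⟨fun hle => lt_of_le_of_ne hle (hσ x hx k).symm, le_of_lt⟩
    obtain ⟨s₁, hs₁, hF₁, hF₁', hE₁⟩ := ih (half_pos hε)
    obtain ⟨s₂, hs₂, hF₂, hE₂⟩ := exists_halfPlaneProd_approx_const hK1
      (measure_mono_null (fun x hx => hx.1) hK0) (hE.union (hK2.image continuous_ofReal))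
      (fun x hx hxE => hxE.elim (hKE x hx.1) fun ⟨y, hy, hyx⟩ =>
        hy.2 (by rw [ofReal_injective hyx]; exact hx.2)) (hc k) (half_pos hε)
    have hb : ∀ x : ℂ, 0 ≤ x.im → ‖halfPlaneProd s₂ x‖ ≤ 1 :=
      fun x hx => norm_halfPlaneProd_le_one hs₂ hx
    refine ⟨s₁ + s₂, fun ρ hρ => (Multiset.mem_add.mp hρ).elim (hs₁ ρ) (hs₂ ρ),
      fun x hx hxF => ?_, fun x hx hxF => ?_, fun z hz => ?_⟩
    · rw [halfPlaneProd_add]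
      by_cases hxk : ⌊(x - σ) / h⌋ = k
      · have := norm_mul_sub_mul_lt (hb x (by simp)) norm_one.le
          (hF₁' x hx (by rw [hxk]; exact hk)) (hF₂ x ⟨hx, hxk⟩)
        rwa [one_mul, ← hxk] at this
      · have := norm_mul_sub_mul_lt (hb x (by simp)) (hc _).le
          (hF₁ x hx (Finset.mem_of_mem_insert_of_ne hxF hxk)) (hE₂ x (Or.inr ⟨x, ⟨hx, hxk⟩, rfl⟩))
        rwa [mul_one] at this
    · rw [Finset.mem_insert, not_or] at hxF
      rw [halfPlaneProd_add]
      have := norm_mul_sub_mul_lt (hb x (by simp)) norm_one.le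
        (hF₁' x hx hxF.2) (hE₂ x (Or.inr ⟨x, ⟨hx, hxF.1⟩, rfl⟩))
      rwa [mul_one] at this
    · rw [halfPlaneProd_add]
      have := norm_mul_sub_mul_lt (hb z (hEim z hz)) norm_one.le (hE₁ z hz) (hE₂ z (Or.inl hz))
      rwa [mul_one] at this

/-- A half-plane Blaschke product close to a unimodular function on a null compact subset of the
boundary and close to one on a compact set disjoint from it. -/
lemma exists_halfPlaneProd_approx {K : Set ℝ} (hKc : IsCompact K) (hK0 : volume K = 0)
    {E : Set ℂ} (hE : IsCompact E) (hKE : ∀ x ∈ K, (x : ℂ) ∉ E) (hEim : ∀ z ∈ E, 0 ≤ z.im)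
    {ψ : ℝ → ℂ} (hψ : ContinuousOn ψ K) (hψ1 : ∀ x ∈ K, ‖ψ x‖ = 1) {ε : ℝ} (hε : 0 < ε) :
    ∃ s : Multiset ℂ, (∀ ρ ∈ s, 0 < ρ.im) ∧ (∀ x ∈ K, ‖halfPlaneProd s x - ψ x‖ < ε) ∧
      ∀ z ∈ E, ‖halfPlaneProd s z - 1‖ < ε := by
  classical
  obtain ⟨h, hh, huc⟩ := Metric.uniformContinuousOn_iff.mp
    (hKc.uniformContinuousOn_of_continuous hψ) (ε / 2) (half_pos hε)
  obtain ⟨σ, hσ⟩ := exists_shift_lattice_disjoint hK0 h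
  obtain ⟨c, hc, hcψ⟩ : ∃ c : ℤ → ℂ, (∀ k, ‖c k‖ = 1) ∧
      ∀ x ∈ K, ‖c ⌊(x - σ) / h⌋ - ψ x‖ < ε / 2 := by
    have hex : ∀ k : ℤ, ∃ v : ℂ, ‖v‖ = 1 ∧ ∀ x ∈ K, ⌊(x - σ) / h⌋ = k → ‖v - ψ x‖ < ε / 2 := by
      intro k
      by_cases hk : ∃ t ∈ K, ⌊(t - σ) / h⌋ = k
      · obtain ⟨t, ht, htk⟩ := hk
        refine ⟨ψ t, hψ1 t ht, fun x hx hxk => ?_⟩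
        rw [← dist_eq_norm]
        refine huc t ht x hx ?_
        have h1 := Int.abs_sub_lt_one_of_floor_eq_floor (htk.trans hxk.symm)
        rw [← sub_div, abs_div, abs_of_pos hh, div_lt_one hh] at h1
        rwa [sub_sub_sub_cancel_right, ← Real.dist_eq] at h1
      · exact ⟨1, norm_one, fun x hx hxk => absurd ⟨x, hx, hxk⟩ hk⟩
    choose c hc hcψ using hex
    exact ⟨c, hc, fun x hx => hcψ _ x hx rfl⟩
  obtain ⟨s, hs, hsK, -, hsE⟩ := exists_halfPlaneProd_approx_step hKc hK0 hE hKE hEim hh hσ hc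
    (finite_image_floor hKc σ hh).toFinset (half_pos hε)
  refine ⟨s, hs, fun x hx => ?_, fun z hz => (hsE z hz).trans (half_lt_self hε)⟩
  have h1 := hsK x hx (by rw [Set.Finite.mem_toFinset]; exact ⟨x, hx, rfl⟩)
  have h2 := norm_sub_le_norm_sub_add_norm_sub (halfPlaneProd s x) (c ⌊(x - σ) / h⌋) (ψ x)
  linarith [hcψ x hx]

/-- The Cayley transform of the disc onto the upper half-plane sending `p` to infinity. -/
def cayleyAt (p z : ℂ) : ℂ := I * (p + z) / (p - z)

lemma cayleyAt_im {p : ℂ} (hp : ‖p‖ = 1) (z : ℂ) :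
    (cayleyAt p z).im = (1 - normSq z) / normSq (p - z) := by
  have hp' : normSq p = 1 := by rw [normSq_eq_norm_sq, hp, one_pow]
  have h : cayleyAt p z = I * ((p + z) * conj (p - z)) / (normSq (p - z) : ℝ) := by
    rw [cayleyAt, div_eq_mul_inv, inv_def]
    push_cast
    ring
  rw [h, div_ofReal_im, I_mul_im, ← hp']
  congr 1
  simp only [normSq_apply, mul_re, add_re, add_im, conj_re, conj_im, sub_re, sub_im]
  ring

lemma cayleyAt_inverse {p : ℂ} (hp : p ≠ 0) {z : ℂ} (hz : z ≠ p) :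
    p * (cayleyAt p z - I) / (cayleyAt p z + I) = z := by
  have hpz : p - z ≠ 0 := sub_ne_zero.mpr hz.symm
  have h1 : cayleyAt p z - I = 2 * I * z / (p - z) := by rw [cayleyAt]; field_simp; ring
  have h2 : cayleyAt p z + I = 2 * I * p / (p - z) := by rw [cayleyAt]; field_simp; ring
  rw [h1, h2]
  field_simp

lemma exists_disc_factor {p ρ : ℂ} (hp : ‖p‖ = 1) (hρ : 0 < ρ.im) :
    ∃ ζ w : ℂ, ‖ζ‖ = 1 ∧ ‖w‖ < 1 ∧ ∀ z ≠ p,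
      (cayleyAt p z - ρ) / (cayleyAt p z - conj ρ) = ζ * ((z - w) / (1 - conj w * z)) := by
  have hp0 : p ≠ 0 := norm_ne_zero_iff.mp (by simp [hp])
  have hρI : ρ + I ≠ 0 := fun h => by
    have := congrArg im h
    simp at this
    linarith
  have hcI : conj ρ - I = conj (ρ + I) := by simp [sub_eq_add_neg]
  have hcI0 : conj ρ - I ≠ 0 := by rw [hcI]; exact (_root_.map_ne_zero _).mpr hρI
  have hpp : conj p * p = 1 := by
    rw [mul_comm, mul_conj, normSq_eq_norm_sq, hp]; simp
  refine ⟨-(ρ + I) / (p * (conj ρ - I)), p * (ρ - I) / (ρ + I), ?_, ?_, fun z hz => ?_⟩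
  · rw [norm_div, norm_neg, norm_mul, hp, one_mul, hcI, RCLike.norm_conj,
      div_self (norm_ne_zero_iff.mpr hρI)]
  · rw [norm_div, norm_mul, hp, one_mul, div_lt_one (norm_pos_iff.mpr hρI)]
    refine lt_of_pow_lt_pow_left₀ 2 (norm_nonneg _) ?_
    rw [← normSq_eq_norm_sq, ← normSq_eq_norm_sq]
    simp only [normSq_apply, sub_re, sub_im, add_re, add_im, I_re, I_im]
    nlinarith
  · have hpz : p - z ≠ 0 := sub_ne_zero.mpr hz.symm
    have h1 : cayleyAt p z - ρ = (ρ + I) * (z - p * (ρ - I) / (ρ + I)) / (p - z) := by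
      rw [cayleyAt]; field_simp; ring
    have h2 : cayleyAt p z - conj ρ =
        -(p * (conj ρ - I)) * (1 - conj (p * (ρ - I) / (ρ + I)) * z) / (p - z) := by
      have h3 : conj (p * (ρ - I) / (ρ + I)) = conj p * (conj ρ + I) / (conj ρ - I) := by
        simp [sub_eq_add_neg]
      rw [h3, cayleyAt, div_sub' hpz]
      congr 1
      field_simp
      linear_combination -(z * (conj ρ + I)) * hpp
    rw [h1, h2, div_div_div_cancel_right₀ hpz, mul_div_mul_comm, neg_div, div_neg]

lemma exists_blaschkeProd_eq_halfPlaneProd {p : ℂ} (hp : ‖p‖ = 1) {s : Multiset ℂ}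
    (hs : ∀ ρ ∈ s, 0 < ρ.im) :
    ∃ (ζ : ℂ) (t : Multiset ℂ), ‖ζ‖ = 1 ∧ (∀ w ∈ t, ‖w‖ < 1) ∧
      ∀ z ≠ p, halfPlaneProd s (cayleyAt p z) = ζ * blaschkeProd t z := by
  induction s using Multiset.induction_on with
  | empty => exact ⟨1, 0, norm_one, by simp, by simp [halfPlaneProd, blaschkeProd]⟩
  | cons ρ s ih =>
    obtain ⟨ζ, t, hζ, ht, hz⟩ := ih fun v hv => hs v (Multiset.mem_cons_of_mem hv)
    obtain ⟨ζ', w, hζ', hw, hz'⟩ := exists_disc_factor hp (hs ρ (Multiset.mem_cons_self ρ s))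
    refine ⟨ζ' * ζ, w ::ₘ t, by rw [norm_mul, hζ, hζ', one_mul], ?_, fun z hzp => ?_⟩
    · exact Multiset.forall_mem_cons.mpr ⟨hw, ht⟩
    · have h := hz z hzp
      rw [halfPlaneProd, blaschkeProd] at h ⊢
      rw [Multiset.map_cons, Multiset.prod_cons, Multiset.map_cons, Multiset.prod_cons, h,
        hz' z hzp]
      ring

lemma volume_circleMap_preimage_eq_zero {K : Set ℂ} (hKc : IsCompact K) (hK0 : arclength K = 0) :
    volume (circleMap 0 1 ⁻¹' K ∩ Ioc 0 (2 * Real.pi)) = 0 := by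
  have hm : Measurable (circleMap 0 1) := (continuous_circleMap 0 1).measurable
  rwa [arclength, Measure.map_apply hm hKc.measurableSet,
    Measure.restrict_apply (hm hKc.measurableSet)] at hK0

lemma exists_unit_notMem {K : Set ℂ} (hKc : IsCompact K) (hK0 : arclength K = 0) :
    ∃ p : ℂ, ‖p‖ = 1 ∧ p ∉ K := by
  by_contra! hall
  have h := volume_circleMap_preimage_eq_zero hKc hK0
  have h1 : circleMap 0 1 ⁻¹' K = univ :=
    eq_univ_of_forall fun θ => hall _ (by simp)
  rw [h1, univ_inter, Real.volume_Ioc, ENNReal.ofReal_eq_zero] at h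
  linarith [Real.pi_pos]

lemma volume_re_cayleyAt_image_eq_zero {K : Set ℂ} (hKc : IsCompact K)
    (hKs : K ⊆ sphere (0:ℂ) 1) (hK0 : arclength K = 0) {p : ℂ} (hpK : p ∉ K) :
    volume ((fun z => (cayleyAt p z).re) '' K) = 0 := by
  set S := circleMap 0 1 ⁻¹' K ∩ Ioc 0 (2 * Real.pi) with hS
  have himg : (fun z => (cayleyAt p z).re) '' K ⊆
      (fun θ => (cayleyAt p (circleMap 0 1 θ)).re) '' S := by
    rintro _ ⟨z, hz, rfl⟩
    have hz1 : z ∈ circleMap 0 1 '' Ioc 0 (2 * Real.pi) := by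
      rw [image_circleMap_Ioc, abs_one]; exact hKs hz
    obtain ⟨θ, hθ, rfl⟩ := hz1
    exact ⟨θ, ⟨hz, hθ⟩, rfl⟩
  refine measure_mono_null himg ?_
  refine addHaar_image_eq_zero_of_differentiableOn_of_addHaar_eq_zero volume (fun θ hθ => ?_)
    (volume_circleMap_preimage_eq_zero hKc hK0)
  have hne : p - circleMap 0 1 θ ≠ 0 := sub_ne_zero.mpr fun h => hpK (h ▸ hθ.1)
  have hd : DifferentiableAt ℝ (circleMap 0 1) θ := differentiable_circleMap 0 1 θ
  have hc : DifferentiableAt ℝ (fun θ => cayleyAt p (circleMap 0 1 θ)) θ := by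
    unfold cayleyAt
    exact DifferentiableAt.div (by fun_prop) (by fun_prop) hne
  exact (reCLM.differentiableAt.comp θ hc).differentiableWithinAt

/-- Simultaneous approximation by a finite Blaschke product: close to a unimodular continuous
`φ` on a measure-zero compact subset `K` of the circle, and to `f ∈ 𝓑` on a compact `L ⊆ 𝔻`. -/
theorem simultaneous_approx_circle (K : Set ℂ) (hKc : IsCompact K)
    (hKs : K ⊆ Metric.sphere (0:ℂ) 1) (hK0 : arclength K = 0)
    (L : Set ℂ) (hLc : IsCompact L) (hLD : L ⊆ Metric.ball (0:ℂ) 1)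
    (φ : ℂ → ℂ) (hφc : ContinuousOn φ K) (hφ1 : ∀ z ∈ K, ‖φ z‖ = 1)
    (f : ℂ → ℂ) (hf : DifferentiableOn ℂ f (Metric.ball (0:ℂ) 1))
    (hfb : ∀ z ∈ Metric.ball (0:ℂ) 1, ‖f z‖ ≤ 1)
    (ε : ℝ) (hε : 0 < ε) :
    ∃ B : ℂ → ℂ, IsFiniteBlaschke B ∧
      (∀ z ∈ K, ‖B z - φ z‖ < ε) ∧ (∀ z ∈ L, ‖B z - f z‖ < ε) := by
  obtain ⟨p, hp, hpK⟩ := exists_unit_notMem hKc hK0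
  have hp0 : p ≠ 0 := norm_ne_zero_iff.mp (by simp [hp])
  obtain ⟨s, hs0, hs, hsL⟩ := exists_blaschkeProd_approx hLc hLD hf hfb (half_pos hε)
  have hKne : ∀ z ∈ K, z ≠ p := fun z hz h => hpK (h ▸ hz)
  have hK1 : ∀ z ∈ K, ‖z‖ = 1 := fun z hz => mem_sphere_zero_iff_norm.mp (hKs hz)
  have hL1 : ∀ z ∈ L, ‖z‖ < 1 := fun z hz => mem_ball_zero_iff.mp (hLD hz)
  have hLne : ∀ z ∈ L, z ≠ p := fun z hz h => by
    have := hL1 z hz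
    rw [h, hp] at this
    exact lt_irrefl _ this
  have hcont : ∀ A : Set ℂ, (∀ z ∈ A, z ≠ p) → ContinuousOn (cayleyAt p) A := fun A hA =>
    ContinuousOn.div (by fun_prop) (by fun_prop) fun z hz => sub_ne_zero.mpr (hA z hz).symm
  have hcayK : ∀ z ∈ K, (((cayleyAt p z).re : ℝ) : ℂ) = cayleyAt p z := fun z hz => by
    apply Complex.ext
    · simp
    · rw [ofReal_im, cayleyAt_im hp, normSq_eq_norm_sq, hK1 z hz]; simp
  have hcayL : ∀ z ∈ L, 0 < (cayleyAt p z).im := fun z hz => by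
    rw [cayleyAt_im hp, normSq_eq_norm_sq]
    refine div_pos ?_ (normSq_pos.mpr (sub_ne_zero.mpr (hLne z hz).symm))
    nlinarith [hL1 z hz, norm_nonneg z]
  have hKx : IsCompact ((fun z => (cayleyAt p z).re) '' K) :=
    hKc.image_of_continuousOn (continuous_re.comp_continuousOn (hcont K hKne))
  set inv : ℝ → ℂ := fun x => p * (x - I) / (x + I) with hinv
  have hinvK : ∀ z ∈ K, inv (cayleyAt p z).re = z := fun z hz => by
    simp only [hinv, hcayK z hz]
    exact cayleyAt_inverse hp0 (hKne z hz)
  have hinvc : Continuous inv := by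
    refine Continuous.div (by fun_prop) (by fun_prop) fun x h => ?_
    simpa using congrArg im h
  have hψc : ContinuousOn (fun z => φ z * conj (blaschkeProd s z)) K :=
    hφc.mul (continuous_conj.comp_continuousOn ((continuousOn_blaschkeProd hs).mono
      (hKs.trans sphere_subset_closedBall)))
  obtain ⟨r, hr, hrK, hrL⟩ := exists_halfPlaneProd_approx hKx
    (volume_re_cayleyAt_image_eq_zero hKc hKs hK0 hpK)
    (hLc.image_of_continuousOn (hcont L hLne))
    (by
      rintro _ ⟨z, hz, rfl⟩ ⟨y, hy, hyz⟩
      have := hcayL y hy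
      rw [hyz, ofReal_im] at this
      exact lt_irrefl _ this)
    (by rintro _ ⟨z, hz, rfl⟩; exact (hcayL z hz).le)
    (ψ := fun x => φ (inv x) * conj (blaschkeProd s (inv x)))
    (hψc.comp hinvc.continuousOn (by
      rintro _ ⟨z, hz, rfl⟩
      rwa [hinvK z hz]))
    (by
      rintro _ ⟨z, hz, rfl⟩
      rw [hinvK z hz, norm_mul, RCLike.norm_conj, hφ1 z hz,
        norm_blaschkeProd_eq_one hs (hK1 z hz), one_mul])
    (half_pos hε)
  obtain ⟨ζ, t, hζ, ht, hzt⟩ := exists_blaschkeProd_eq_halfPlaneProd hp hr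
  refine ⟨fun z => ζ * blaschkeProd (s + t) z, ?_, fun z hz => ?_, fun z hz => ?_⟩
  · refine isFiniteBlaschke_const_mul_blaschkeProd hζ
      (fun w hw => (Multiset.mem_add.mp hw).elim (hs w) (ht w)) fun h => hs0 ?_
    exact Multiset.le_zero.mp (h ▸ Multiset.le_add_right s t)
  · have h1 := hrK _ ⟨z, hz, rfl⟩
    simp only [hcayK z hz, hinvK z hz] at h1
    rw [hzt z (hKne z hz)] at h1
    have hB : blaschkeProd s z * conj (blaschkeProd s z) = 1 := by
      rw [mul_conj, normSq_eq_norm_sq, norm_blaschkeProd_eq_one hs (hK1 z hz)]; simp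
    have h2 : ζ * blaschkeProd (s + t) z - φ z =
        blaschkeProd s z * (ζ * blaschkeProd t z - φ z * conj (blaschkeProd s z)) := by
      rw [blaschkeProd_add]
      linear_combination φ z * hB
    rw [h2, norm_mul, norm_blaschkeProd_eq_one hs (hK1 z hz), one_mul]
    linarith
  · have h1 := hrL _ ⟨z, hz, rfl⟩
    rw [hzt z (hLne z hz)] at h1
    have h2 : ζ * blaschkeProd (s + t) z - f z =
        blaschkeProd s z * (ζ * blaschkeProd t z - 1) + (blaschkeProd s z - f z) := by
      rw [blaschkeProd_add]
      ring
    rw [h2]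
    have h3 := norm_add_le (blaschkeProd s z * (ζ * blaschkeProd t z - 1)) (blaschkeProd s z - f z)
    rw [norm_mul] at h3
    nlinarith [hsL z hz, norm_blaschkeProd_le_one hs (hL1 z hz).le,
      norm_nonneg (ζ * blaschkeProd t z - 1)]
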